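/- Let f : 2^V → ℝ₊ be a nonnegative monotone submodular set function on ground set V = {1,…,n}, let F be its multilinear extension, and let m_f := max_{i ∈ {1,…,n}} f({i}). Then for every x ∈ [0,1]ⁿ and all coordinates i, j: |∂²F/∂x_i∂x_j(x)| ≤ m_f; i.e., every entry of the Hessian of F is bounded in magnitude by the maximum singleton value of f. -/

import Mathlib

/-- The multilinear extension `G(x) = Σ_{S ⊆ V} g(S) ∏_{i∈S} x_i ∏_{j∉S} (1 − x_j)`
of a set function on the ground set `V = {1,…,n}`. -/
noncomputable def multilinearExt {n : ℕ} (f : Finset (Fin n) → ℝ)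
    (x : EuclideanSpace ℝ (Fin n)) : ℝ :=
  ∑ S : Finset (Fin n), f S * ((∏ i ∈ S, x i) * ∏ j ∈ Sᶜ, (1 - x j))

/-- The discrete partial derivative of a set function in direction `j`. -/
def discreteDeriv {n : ℕ} (j : Fin n) (f : Finset (Fin n) → ℝ) (S : Finset (Fin n)) : ℝ :=
  f (insert j S) - f (S.erase j)

/-- Conditioning the multilinear extension on the coordinate `j`. -/
theorem multilinearExt_eq_sum_erase {n : ℕ} (f : Finset (Fin n) → ℝ) (j : Fin n)
    (x : EuclideanSpace ℝ (Fin n)) :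
    multilinearExt f x = ∑ t ∈ (Finset.univ.erase j).powerset,
      (x j * f (insert j t) + (1 - x j) * f t) *
        ((∏ i ∈ t, x i) * ∏ i ∈ (insert j t)ᶜ, (1 - x i)) := by
  have huniv : (Finset.univ : Finset (Finset (Fin n))) =
      (insert j (Finset.univ.erase j)).powerset := by
    rw [Finset.insert_erase (Finset.mem_univ j), Finset.powerset_univ]
  rw [multilinearExt, huniv, Finset.sum_powerset_insert (Finset.notMem_erase j _),
    ← Finset.sum_add_distrib]
  refine Finset.sum_congr rfl fun t ht => ?_
  have hjt : j ∉ t := fun h => Finset.notMem_erase j _ (Finset.mem_powerset.1 ht h)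
  have hc : tᶜ = insert j (insert j t)ᶜ := by
    ext k
    by_cases hk : k = j <;> simp [hk, hjt]
  rw [hc, Finset.prod_insert (by simp), Finset.prod_insert hjt]
  ring

/-- The multilinear extension is affine along each coordinate direction. -/
theorem multilinearExt_add_smul_single {n : ℕ} (f : Finset (Fin n) → ℝ) (j : Fin n)
    (x : EuclideanSpace ℝ (Fin n)) (s : ℝ) :
    multilinearExt f (x + s • EuclideanSpace.single j 1) =
      multilinearExt f x + s * multilinearExt (discreteDeriv j f) x := by
  simp only [multilinearExt_eq_sum_erase _ j]
  rw [Finset.mul_sum, ← Finset.sum_add_distrib]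
  refine Finset.sum_congr rfl fun t ht => ?_
  have hjt : j ∉ t := fun h => Finset.notMem_erase j _ (Finset.mem_powerset.1 ht h)
  have hne : ∀ k, k ≠ j → (x + s • EuclideanSpace.single j (1 : ℝ)) k = x k := by
    intro k hk
    simp [hk]
  have h₁ : ∏ i ∈ t, (x + s • EuclideanSpace.single j (1 : ℝ)) i = ∏ i ∈ t, x i :=
    Finset.prod_congr rfl fun k hk => hne k (ne_of_mem_of_not_mem hk hjt)
  have h₂ : ∏ i ∈ (insert j t)ᶜ, (1 - (x + s • EuclideanSpace.single j (1 : ℝ)) i) =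
      ∏ i ∈ (insert j t)ᶜ, (1 - x i) :=
    Finset.prod_congr rfl fun k hk => by
      rw [hne k (by rintro rfl; simp at hk)]
  have hj : (x + s • EuclideanSpace.single j (1 : ℝ)) j = x j + s := by simp
  rw [h₁, h₂, hj]
  simp only [discreteDeriv, Finset.insert_idem, Finset.erase_insert hjt,
    Finset.erase_eq_of_notMem hjt]
  ring

theorem differentiable_multilinearExt {n : ℕ} (f : Finset (Fin n) → ℝ) :
    Differentiable ℝ (multilinearExt f) := by
  unfold multilinearExt
  fun_prop

theorem fderiv_multilinearExt_single {n : ℕ} (f : Finset (Fin n) → ℝ) (j : Fin n)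
    (x : EuclideanSpace ℝ (Fin n)) :
    fderiv ℝ (multilinearExt f) x (EuclideanSpace.single j 1) =
      multilinearExt (discreteDeriv j f) x := by
  have h₁ := ((differentiable_multilinearExt f x).hasFDerivAt.hasLineDerivAt
    (EuclideanSpace.single j 1))
  unfold HasLineDerivAt at h₁
  simp only [multilinearExt_add_smul_single] at h₁
  have h₂ := ((hasDerivAt_id (0 : ℝ)).mul_const
    (multilinearExt (discreteDeriv j f) x)).const_add (multilinearExt f x)
  simpa using h₁.unique h₂

/-- On the unit cube, the multilinear extension averages the values of the set function. -/
theorem abs_multilinearExt_le {n : ℕ} {f : Finset (Fin n) → ℝ} {c : ℝ} (hf : ∀ S, |f S| ≤ c)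
    {x : EuclideanSpace ℝ (Fin n)} (hx : ∀ j, x j ∈ Set.Icc (0 : ℝ) 1) :
    |multilinearExt f x| ≤ c := by
  have hsum : ∑ S : Finset (Fin n), (∏ i ∈ S, x i) * ∏ j ∈ Sᶜ, (1 - x j) = 1 := by
    rw [← Fintype.prod_add]
    simp
  have hnonneg : ∀ S : Finset (Fin n), 0 ≤ (∏ i ∈ S, x i) * ∏ j ∈ Sᶜ, (1 - x j) := fun S =>
    mul_nonneg (Finset.prod_nonneg fun i _ => (hx i).1)
      (Finset.prod_nonneg fun i _ => sub_nonneg.2 (hx i).2)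
  calc |multilinearExt f x|
      ≤ ∑ S : Finset (Fin n), |f S * ((∏ i ∈ S, x i) * ∏ j ∈ Sᶜ, (1 - x j))| :=
        Finset.abs_sum_le_sum_abs _ _
    _ ≤ ∑ S : Finset (Fin n), c * ((∏ i ∈ S, x i) * ∏ j ∈ Sᶜ, (1 - x j)) := by
        refine Finset.sum_le_sum fun S _ => ?_
        rw [abs_mul, abs_of_nonneg (hnonneg S)]
        exact mul_le_mul_of_nonneg_right (hf S) (hnonneg S)
    _ = c := by rw [← Finset.mul_sum, hsum, mul_one]

/-- Second discrete derivatives of a nonnegative monotone submodular function are bounded by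
singleton values. -/
theorem abs_discreteDeriv_discreteDeriv_le {n : ℕ} {f : Finset (Fin n) → ℝ}
    (hf_nonneg : ∀ S, 0 ≤ f S)
    (hf_mono : ∀ A B : Finset (Fin n), A ⊆ B → f A ≤ f B)
    (hf_submod : ∀ A B : Finset (Fin n), f (A ∩ B) + f (A ∪ B) ≤ f A + f B)
    (i j : Fin n) (S : Finset (Fin n)) :
    |discreteDeriv i (discreteDeriv j f) S| ≤ f {j} := by
  have hbound : ∀ T, 0 ≤ discreteDeriv j f T ∧ discreteDeriv j f T ≤ f {j} := by
    intro T
    have h₁ := hf_mono (T.erase j) (insert j T)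
      ((Finset.erase_subset _ _).trans (Finset.subset_insert _ _))
    have h₂ := hf_submod (T.erase j) {j}
    have h₃ : T.erase j ∪ {j} = insert j T := by
      ext k
      by_cases hk : k = j <;> simp [hk]
    rw [h₃] at h₂
    have h₄ := hf_nonneg (T.erase j ∩ {j})
    unfold discreteDeriv
    constructor <;> linarith
  have h₁ := hbound (insert i S)
  have h₂ := hbound (S.erase i)
  rw [discreteDeriv, abs_le]
  constructor <;> linarith

/-- For a nonnegative monotone submodular set function `f` with
multilinear extension `F` and `m_f = max_i f({i})`, every entry of the Hessian of `F` at any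
`x ∈ [0,1]ⁿ` is bounded in magnitude by `m_f`: `|∂²F/∂x_i∂x_j(x)| ≤ m_f`. -/
theorem stmt12 {n : ℕ} (f : Finset (Fin n) → ℝ)
    (hf_nonneg : ∀ S, 0 ≤ f S)
    (hf_mono : ∀ A B : Finset (Fin n), A ⊆ B → f A ≤ f B)
    (hf_submod : ∀ A B : Finset (Fin n), f (A ∩ B) + f (A ∪ B) ≤ f A + f B)
    (mf : ℝ) (hmf : mf = sSup (Set.range fun i : Fin n => f {i}))
    (x : EuclideanSpace ℝ (Fin n)) (hx : ∀ j, x j ∈ Set.Icc (0 : ℝ) 1) (i j : Fin n) :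
    |fderiv ℝ (fun y => fderiv ℝ (multilinearExt f) y (EuclideanSpace.single j 1)) x
        (EuclideanSpace.single i 1)| ≤ mf := by
  have hle : f {j} ≤ mf := by
    rw [hmf]
    exact le_csSup (Set.finite_range _).bddAbove ⟨j, rfl⟩
  simp only [fderiv_multilinearExt_single]
  exact abs_multilinearExt_le (fun S =>
    (abs_discreteDeriv_discreteDeriv_le hf_nonneg hf_mono hf_submod i j S).trans hle) hx
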